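/- arXiv:1701.02293 — 2 statements merged into one kernel-verified Lean document; each statement's English description precedes it below -/
import Mathlib

section
/- Morse Lemma: Let f : ℝⁿ → ℝ be a smooth function such that the origin is a critical point (the Fréchet derivative of f at 0 is zero) and the Hessian of f at 0 is non-degenerate with exactly λ negative eigenvalues counted with multiplicity (and n − λ positive eigenvalues). Then there exist open neighborhoods U and V of the origin in ℝⁿ and a smooth diffeomorphism ψ : V → U with ψ(0) = 0 such that for all u = (u₁,…,uₙ) ∈ V, f(ψ(u)) = f(0) − u₁² − ⋯ − u_λ² + u_{λ+1}² + ⋯ + uₙ². -/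
set_option maxSynthPendingDepth 3

open Filter Topology ContDiff

universe u

section ParametricIntegral

variable {E F : Type u} [NormedAddCommGroup E] [NormedSpace ℝ E]
  [NormedAddCommGroup F] [NormedSpace ℝ F]

/-- Differentiation under an interval integral of a jointly `C¹` integrand. -/
theorem ContDiff.hasFDerivAt_intervalIntegral {G : E → ℝ → F}
    (hG : ContDiff ℝ 1 (Function.uncurry G)) (a b : ℝ) (x₀ : E) :
    HasFDerivAt (fun x => ∫ t in a..b, G x t)
      (∫ t in a..b, (fderiv ℝ (Function.uncurry G) (x₀, t)).comp
        (ContinuousLinearMap.inl ℝ E ℝ)) x₀ := by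
  set G' : E × ℝ → E →L[ℝ] F := fun p =>
    (fderiv ℝ (Function.uncurry G) p).comp (ContinuousLinearMap.inl ℝ E ℝ)
  have hG'c : Continuous G' := (hG.continuous_fderiv one_ne_zero).clm_comp continuous_const
  have hK : IsCompact (Set.uIcc a b) := isCompact_uIcc
  obtain ⟨C, hC⟩ := hK.exists_bound_of_continuousOn
    (f := fun t => G' (x₀, t)) (hG'c.comp (Continuous.prodMk_right x₀)).continuousOn
  have hev : ∀ᶠ x in 𝓝 x₀, ∀ t ∈ Set.uIcc a b, ‖G' (x, t)‖ < C + 1 := by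
    refine hK.eventually_forall_of_forall_eventually
      (P := fun x t => ‖G' (x, t)‖ < C + 1) fun t ht => ?_
    exact hG'c.norm.continuousAt.eventually_lt continuousAt_const
      ((hC t ht).trans_lt (lt_add_one C))
  have hGx (x : E) : Continuous (G x) := hG.continuous.comp (Continuous.prodMk_right x)
  refine intervalIntegral.hasFDerivAt_integral_of_dominated_of_fderiv_le
    (F' := fun x t => G' (x, t)) (bound := fun _ => C + 1) hev
    (Eventually.of_forall fun x => (hGx x).aestronglyMeasurable)
    ((hGx x₀).intervalIntegrable a b)
    (hG'c.comp (Continuous.prodMk_right x₀)).aestronglyMeasurable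
    (Eventually.of_forall fun t ht x hx => (hx t (Set.uIoc_subset_uIcc ht)).le)
    intervalIntegrable_const
    (Eventually.of_forall fun t _ x _ => ?_)
  have hx := (hG.differentiable one_ne_zero (x, t)).hasFDerivAt
  exact hx.comp (f := fun y => (y, t)) x (hasFDerivAt_prodMk_left (𝕜 := ℝ) x t)

/-- The interval integral of a jointly smooth integrand depends smoothly on the parameter. -/
theorem ContDiff.intervalIntegral_param {G : E → ℝ → F}
    (hG : ContDiff ℝ ∞ (Function.uncurry G)) (a b : ℝ) :
    ContDiff ℝ ∞ (fun x => ∫ t in a..b, G x t) := by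
  refine contDiff_infty.2 fun n => ?_
  induction n generalizing F with
  | zero =>
    exact contDiff_zero.2
      (intervalIntegral.continuous_parametric_intervalIntegral_of_continuous' hG.continuous a b)
  | succ n ih =>
    have hd := (hG.of_le (m := 1) (by exact_mod_cast le_top)).hasFDerivAt_intervalIntegral a b
    rw [Nat.cast_succ, contDiff_succ_iff_fderiv]
    refine ⟨fun x => (hd x).differentiableAt, by simp, ?_⟩
    rw [funext fun x => (hd x).fderiv]
    refine ih (G := fun x t => (fderiv ℝ (Function.uncurry G) (x, t)).comp
        (ContinuousLinearMap.inl ℝ E ℝ)) ?_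
    exact (hG.fderiv_right (m := ∞) (by simp)).clm_comp contDiff_const

end ParametricIntegral

section Hadamard

variable {E : Type u} [NormedAddCommGroup E] [NormedSpace ℝ E]

/-- A second-order Hadamard lemma at a critical point. -/
theorem ContDiff.exists_eq_add_half_bilin {f : E → ℝ} (hf : ContDiff ℝ ∞ f)
    (hcrit : fderiv ℝ f 0 = 0) :
    ∃ H : E → E →L[ℝ] E →L[ℝ] ℝ, ContDiff ℝ ∞ H ∧ H 0 = fderiv ℝ (fderiv ℝ f) 0 ∧
      (∀ x u v, H x u v = H x v u) ∧ ∀ x, f x = f 0 + 1 / 2 * H x x x := by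
  have hf1 : ContDiff ℝ ∞ (fderiv ℝ f) := hf.fderiv_right (by simp)
  have hf2 : ContDiff ℝ ∞ (fderiv ℝ (fderiv ℝ f)) := hf1.fderiv_right (by simp)
  have hsymm (x u v : E) : fderiv ℝ (fderiv ℝ f) x u v = fderiv ℝ (fderiv ℝ f) x v u :=
    (hf.contDiffAt.isSymmSndFDerivAt (by simpa using WithTop.coe_le_coe.2 (le_top (a := (2 : ℕ∞))))) u v
  set G : E → ℝ → E →L[ℝ] E →L[ℝ] ℝ := fun x t => (2 * (1 - t)) • fderiv ℝ (fderiv ℝ f) (t • x)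
    with hGdef
  have hG : ContDiff ℝ ∞ (Function.uncurry G) := by
    have : ContDiff ℝ ∞ (fun p : E × ℝ => fderiv ℝ (fderiv ℝ f) (p.2 • p.1)) :=
      hf2.comp (contDiff_snd.smul contDiff_fst)
    have h2 : ContDiff ℝ ∞ (fun p : E × ℝ => 2 * (1 - p.2)) := by fun_prop
    exact h2.smul this
  have hGx (x : E) : Continuous (G x) := hG.continuous.comp (Continuous.prodMk_right x)
  have happ (x u v : E) : (∫ t in (0 : ℝ)..1, G x t) u v = ∫ t in (0 : ℝ)..1, G x t u v := by
    rw [ContinuousLinearMap.intervalIntegral_apply ((hGx x).intervalIntegrable _ _),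
      ContinuousLinearMap.intervalIntegral_apply
        (((hGx x).clm_apply continuous_const).intervalIntegrable _ _)]
  refine ⟨fun x => ∫ t in (0 : ℝ)..1, G x t, hG.intervalIntegral_param 0 1, ?_, ?_, ?_⟩
  · have : ∫ t in (0 : ℝ)..1, 2 * (1 - t) = 1 := by
      rw [intervalIntegral.integral_const_mul, intervalIntegral.integral_sub] <;> norm_num
    simp only [hGdef, smul_zero]
    rw [intervalIntegral.integral_smul_const, this, one_smul]
  · intro x u v
    refine (happ x u v).trans (Eq.trans ?_ (happ x v u).symm)
    simp only [hGdef, smul_apply, hsymm (_ • x) u v]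
  · intro x
    have hline (t : ℝ) : HasDerivAt (fun t : ℝ => t • x) x t := by
      simpa using (hasDerivAt_id t).smul_const x
    have h0 (t : ℝ) : HasDerivAt (fun t : ℝ => f (t • x)) (fderiv ℝ f (t • x) x) t :=
      (hf.differentiable (by simp) (t • x)).hasFDerivAt.comp_hasDerivAt t (hline t)
    have h1 (t : ℝ) : HasDerivAt (fun t : ℝ => fderiv ℝ f (t • x) x)
        (fderiv ℝ (fderiv ℝ f) (t • x) x x) t := by
      have := (hf1.differentiable (by simp) (t • x)).hasFDerivAt.comp_hasDerivAt t (hline t)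
      simpa using this.clm_apply (hasDerivAt_const t x)
    have h2 (t : ℝ) : HasDerivAt
        (fun t : ℝ => 2 * ((1 - t) * fderiv ℝ f (t • x) x + f (t • x))) (G x t x x) t := by
      have := ((((hasDerivAt_const t (1 : ℝ)).sub (hasDerivAt_id t)).mul (h1 t)).add
        (h0 t)).const_mul 2
      refine this.congr_deriv ?_
      simp [hGdef]
      ring
    have := intervalIntegral.integral_eq_sub_of_hasDerivAt (a := 0) (b := 1) (fun t _ => h2 t)
      ((((hGx x).clm_apply continuous_const).clm_apply continuous_const).intervalIntegrable _ _)
    rw [happ, this]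
    simp [hcrit]
    ring

end Hadamard

section LocalInverse

variable {E F : Type*} [NormedAddCommGroup E] [NormedSpace ℝ E] [CompleteSpace E]
  [NormedAddCommGroup F] [NormedSpace ℝ F]

/-- Inverse function theorem: a map which is `Cⁿ` near `a` and whose derivative at `a` is
invertible restricts to a `Cⁿ` diffeomorphism between open sets. -/
theorem exists_openPartialHomeomorph_contDiffOn {n : ℕ∞ω} (hn : n ≠ 0) {φ : E → F} {a : E}
    {φ' : E ≃L[ℝ] F} (hφ : ∀ᶠ x in 𝓝 a, ContDiffAt ℝ n φ x)
    (hφ' : HasFDerivAt φ (φ' : E →L[ℝ] F) a) {s : Set E} (hs : s ∈ 𝓝 a) :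
    ∃ e : OpenPartialHomeomorph E F, (e : E → F) = φ ∧ a ∈ e.source ∧ e.source ⊆ s ∧
      ContDiffOn ℝ n e e.source ∧ ContDiffOn ℝ n e.symm e.target := by
  have ha := hφ.self_of_nhds
  let e₀ := ha.toOpenPartialHomeomorph φ hφ' hn
  have hinv : ∀ᶠ x in 𝓝 a, fderiv ℝ φ x ∈ Set.range ((↑) : (E ≃L[ℝ] F) → E →L[ℝ] F) :=
    (ha.fderiv_right (m := 0) (by simpa using ENat.one_le_iff_ne_zero_withTop.2 hn)
      ).continuousAt.eventually_mem (by rw [hφ'.fderiv]; exact φ'.nhds)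
  obtain ⟨t, hts, ht, hat⟩ := mem_nhds_iff.1 (inter_mem hs (inter_mem hφ hinv))
  refine ⟨e₀.restrOpen t ht, rfl, ⟨ha.mem_toOpenPartialHomeomorph_source hφ' hn, hat⟩,
    fun x hx => (hts hx.2).1, fun x hx => (hts hx.2).2.1.contDiffWithinAt, fun y hy => ?_⟩
  have hx := hts ((e₀.restrOpen t ht).map_target hy).2
  obtain ⟨ψ', hψ'⟩ := hx.2.2
  refine ((e₀.restrOpen t ht).contDiffAt_symm (f₀' := ψ') hy ?_ hx.2.1).contDiffWithinAt
  rw [hψ']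
  exact (hx.2.1.differentiableAt hn).hasFDerivAt

end LocalInverse

section MorsePalais

variable {E : Type u} [NormedAddCommGroup E] [NormedSpace ℝ E] [CompleteSpace E]

/-- In a real Banach algebra, squaring has a smooth local inverse at `1`. -/
theorem exists_openPartialHomeomorph_sq (W : Type*) [NormedRing W] [NormedAlgebra ℝ W]
    [CompleteSpace W] :
    ∃ e : OpenPartialHomeomorph W W, (∀ w, e w = w * w) ∧ (1 : W) ∈ e.source ∧
      ContDiffOn ℝ ∞ e.symm e.target := by
  have hsq : ContDiff ℝ ∞ (fun w : W => w * w) := contDiff_id.mul contDiff_id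
  have hd : HasFDerivAt (fun w : W => w * w)
      ((ContinuousLinearEquiv.smulLeft (Units.mk0 (2 : ℝ) two_ne_zero) : W ≃L[ℝ] W) :
        W →L[ℝ] W) 1 := by
    refine ((hasFDerivAt_id (1 : W)).mul' (hasFDerivAt_id (1 : W))).congr_fderiv ?_
    ext w
    simp [two_smul]
  obtain ⟨e, he, h1, -, -, hs⟩ := exists_openPartialHomeomorph_contDiffOn (n := ∞) (by simp)
    (Eventually.of_forall fun w => hsq.contDiffAt) hd univ_mem
  exact ⟨e, fun w => by rw [he], h1, hs⟩

/-- **Morse–Palais lemma.** Near a non-degenerate critical point, a smooth function on a Banach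
space is, up to a smooth change of coordinates, its second-order Taylor polynomial. -/
theorem morse_palais {f : E → ℝ} (hf : ContDiff ℝ ∞ f) (hcrit : fderiv ℝ f 0 = 0)
    (D : E ≃L[ℝ] (E →L[ℝ] ℝ)) (hD : (D : E →L[ℝ] E →L[ℝ] ℝ) = fderiv ℝ (fderiv ℝ f) 0) :
    ∃ φ : OpenPartialHomeomorph E E, 0 ∈ φ.source ∧ φ 0 = 0 ∧
      ContDiffOn ℝ ∞ φ φ.source ∧ ContDiffOn ℝ ∞ φ.symm φ.target ∧
      ∀ x ∈ φ.source, f x = f 0 + 1 / 2 * D (φ x) (φ x) := by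
  obtain ⟨H, hH, hH0, hsymm, hfH⟩ := hf.exists_eq_add_half_bilin hcrit
  rw [← hD] at hH0
  have hDsymm (u v : E) : D u v = D v u := by simpa [hH0] using hsymm 0 u v
  obtain ⟨e, he, h1, hes⟩ := exists_openPartialHomeomorph_sq (E →L[ℝ] E)
  set K : E → E →L[ℝ] E := fun x => (D.symm : (E →L[ℝ] ℝ) →L[ℝ] E).comp (H x) with hKdef
  have hK : ContDiff ℝ ∞ K := contDiff_const.clm_comp hH
  have hDK (x u v : E) : D (K x u) v = H x u v := by simp [hKdef]
  have hK0 : K 0 = 1 := by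
    ext u
    simp [hKdef, hH0]
  have he1 : e 1 = 1 := by simp [he]
  have h1t : (1 : E →L[ℝ] E) ∈ e.target := by simpa [he1] using e.map_source h1
  have hes1 : e.symm 1 = 1 := by simpa [he1] using e.left_inv h1
  set R : E → E →L[ℝ] E := fun x => e.symm (K x) with hRdef
  have hR0 : R 0 = 1 := by simp [hRdef, hK0, hes1]
  have hRs : ∀ᶠ x in 𝓝 0, ContDiffAt ℝ ∞ R x ∧ R x * R x = K x := by
    have : ∀ᶠ x in 𝓝 0, K x ∈ e.target :=
      hK.continuous.continuousAt.eventually_mem (by rw [hK0]; exact e.open_target.mem_nhds h1t)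
    filter_upwards [this] with x hx
    refine ⟨(hes.contDiffAt (e.open_target.mem_nhds hx)).comp x hK.contDiffAt, ?_⟩
    rw [← he, e.right_inv hx]
  have hRc : ContinuousAt R 0 := hRs.self_of_nhds.1.continuousAt
  -- the adjoint with respect to the bilinear form `D`
  let adj : (E →L[ℝ] E) → (E →L[ℝ] E) := fun T =>
    (D.symm : (E →L[ℝ] ℝ) →L[ℝ] E).comp
      (((ContinuousLinearMap.compL ℝ E E ℝ).flip T).comp (D : E →L[ℝ] E →L[ℝ] ℝ))
  have hadj (T : E →L[ℝ] E) (u v : E) : D (adj T u) v = D u (T v) := by simp [adj]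
  have hadjc : Continuous adj := by fun_prop
  have hadj1 : adj 1 = 1 := by
    ext u
    apply D.injective
    ext v
    simp [hadj]
  have hself : ∀ᶠ x in 𝓝 0, adj (R x) = R x := by
    have hmem : ∀ᶠ x in 𝓝 0, adj (R x) ∈ e.source := by
      refine (hadjc.continuousAt.comp hRc).eventually_mem ?_
      simpa [hR0, hadj1] using e.open_source.mem_nhds h1
    filter_upwards [hmem, hRs] with x hx hxR
    have hsq : adj (R x) * adj (R x) = K x := by
      ext u
      apply D.injective
      ext v
      rw [mul_apply_eq_comp, hadj, hadj, ← mul_apply_eq_comp, hxR.2,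
        hDsymm, hDK, hDK, hsymm]
    rw [← e.left_inv hx, he, hsq]
  have hφ : ∀ᶠ x in 𝓝 0, ContDiffAt ℝ ∞ (fun x => R x x) x :=
    hRs.mono fun x hx => hx.1.clm_apply contDiffAt_id
  have hφ' : HasFDerivAt (fun x => R x x)
      ((ContinuousLinearEquiv.refl ℝ E : E ≃L[ℝ] E) : E →L[ℝ] E) 0 := by
    refine ((hRs.self_of_nhds.1.differentiableAt (by simp)).hasFDerivAt.clm_apply
      (hasFDerivAt_id 0)).congr_fderiv ?_
    ext u
    simp [hR0]
  obtain ⟨φ, hφe, h0, hsub, hs, hs'⟩ := exists_openPartialHomeomorph_contDiffOn (n := ∞)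
    (by simp) hφ hφ' (hRs.and hself)
  refine ⟨φ, h0, by simp [hφe], hs, hs', fun x hx => ?_⟩
  obtain ⟨⟨-, hsq⟩, hsa⟩ := hsub hx
  have : D (R x x) (R x x) = H x x x := by
    conv_lhs => rw [← hsa]
    rw [hadj, hsa, ← mul_apply_eq_comp, hsq, hDsymm, hDK]
  rw [hfH, hφe, this]

end MorsePalais

section QuadraticForm

/-- A predicate holding for exactly `l` elements of `Fin n` can be permuted to `i < l`. -/
theorem exists_perm_iff_lt {n l : ℕ} {p : Fin n → Prop} [DecidablePred p]
    (hp : (Finset.univ.filter p).card = l) :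
    ∃ σ : Equiv.Perm (Fin n), ∀ i, p (σ i) ↔ (i : ℕ) < l := by
  have hl : l ≤ n := by simpa [hp] using Finset.card_le_univ (Finset.univ.filter p)
  have hcard : Fintype.card {i : Fin n // (i : ℕ) < l} = Fintype.card {i // p i} := by
    rw [Fintype.card_subtype, Fintype.card_subtype, hp, Fin.card_filter_val_lt, min_eq_right hl]
  let e := Fintype.equivOfCardEq hcard
  refine ⟨e.extendSubtype, fun i => ⟨fun h => ?_, fun h => e.extendSubtype_mem i h⟩⟩
  by_contra hi
  exact e.extendSubtype_not_mem i hi h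

/-- A bilinear form whose matrix is invertible and symmetric with `l` negative eigenvalues is
non-degenerate, and in suitable linear coordinates half of its quadratic form is a signed sum of
squares with `l` minus signs. -/
theorem exists_equiv_diag {n l : ℕ}
    (B : EuclideanSpace ℝ (Fin n) →L[ℝ] EuclideanSpace ℝ (Fin n) →L[ℝ] ℝ)
    (A : Matrix (Fin n) (Fin n) ℝ)
    (hAB : ∀ i j, A i j = B (EuclideanSpace.single i 1) (EuclideanSpace.single j 1))
    (hA : A.IsHermitian) (hdet : A.det ≠ 0)
    (hneg : (Finset.univ.filter (fun i => hA.eigenvalues i < 0)).card = l) :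
    ∃ (D : EuclideanSpace ℝ (Fin n) ≃L[ℝ] (EuclideanSpace ℝ (Fin n) →L[ℝ] ℝ))
      (P : EuclideanSpace ℝ (Fin n) ≃L[ℝ] EuclideanSpace ℝ (Fin n)),
      (D : EuclideanSpace ℝ (Fin n) →L[ℝ] EuclideanSpace ℝ (Fin n) →L[ℝ] ℝ) = B ∧
      ∀ u, 1 / 2 * D (P u) (P u) = ∑ i : Fin n, (if (i : ℕ) < l then -1 else 1) * (u i) ^ 2 := by
  set b := hA.eigenvectorBasis
  set μ := hA.eigenvalues
  have hμ0 (i : Fin n) : μ i ≠ 0 := by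
    intro h
    apply hdet
    rw [hA.det_eq_prod_eigenvalues]
    exact Finset.prod_eq_zero (Finset.mem_univ i) (by simpa using h)
  have hBA (u v : EuclideanSpace ℝ (Fin n)) :
      B u v = inner ℝ u (WithLp.toLp 2 (A.mulVec v.ofLp)) := by
    have hu : u = ∑ i, u i • EuclideanSpace.single i (1 : ℝ) := by
      simpa using ((EuclideanSpace.basisFun (Fin n) ℝ).sum_repr u).symm
    have hv : v = ∑ i, v i • EuclideanSpace.single i (1 : ℝ) := by
      simpa using ((EuclideanSpace.basisFun (Fin n) ℝ).sum_repr v).symm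
    conv_lhs => rw [hu, hv]
    simp [PiLp.inner_apply, Matrix.mulVec, dotProduct, ← hAB, Finset.mul_sum, Finset.sum_mul]
    rw [Finset.sum_comm]
    exact Finset.sum_congr rfl fun _ _ => Finset.sum_congr rfl fun _ _ => by ring
  have hBb (v : EuclideanSpace ℝ (Fin n)) (i : Fin n) : B v (b i) = μ i * inner ℝ v (b i) := by
    rw [hBA, hA.mulVec_eigenvectorBasis, WithLp.toLp_smul, inner_smul_right]
  have hBbb (i j : Fin n) : B (b i) (b j) = if i = j then μ i else 0 := by
    rw [hBb, b.inner_eq_ite]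
    split_ifs with h <;> simp [h]
  have hinj : Function.Injective B := by
    rw [injective_iff_map_eq_zero]
    intro v hv
    refine b.toBasis.ext_elem fun i => ?_
    have := hBb v i
    simpa [hv, hμ0 i, real_inner_comm, b.repr_apply_apply] using this
  obtain ⟨σ, hσ⟩ := exists_perm_iff_lt hneg
  let c : Fin n → ℝ := fun i => √(2 / |μ (σ i)|)
  have hc (i : Fin n) : c i ≠ 0 := by
    have := abs_pos.2 (hμ0 (σ i))
    positivity
  have hcμ (i : Fin n) : 1 / 2 * (c i ^ 2 * μ (σ i)) = if (i : ℕ) < l then -1 else 1 := by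
    have h := hμ0 (σ i)
    rw [Real.sq_sqrt (by positivity)]
    split_ifs with hi
    · rw [abs_of_neg ((hσ i).2 hi)]
      field_simp
    · rw [abs_of_pos (lt_of_le_of_ne (not_lt.1 (mt (hσ i).1 hi)) h.symm)]
      field_simp
  let bas := (b.toBasis.reindex σ.symm).unitsSMul (fun i => Units.mk0 (c i) (hc i))
  have hbas (i : Fin n) : bas i = c i • b (σ i) := by
    simp [bas, Module.Basis.unitsSMul_apply, Units.smul_def]
  let P := (EuclideanSpace.basisFun (Fin n) ℝ).toBasis.equiv bas (Equiv.refl _)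
  have hP (u : EuclideanSpace ℝ (Fin n)) : P u = ∑ i, (u i * c i) • b (σ i) := by
    conv_lhs => rw [← (EuclideanSpace.basisFun (Fin n) ℝ).toBasis.sum_repr u]
    rw [map_sum]
    refine Finset.sum_congr rfl fun i _ => ?_
    simp only [P, map_smul, Module.Basis.equiv_apply, Equiv.refl_apply, hbas, mul_smul]
    simp
  let D := (LinearMap.linearEquivOfInjective B.toLinearMap hinj
    (InnerProductSpace.toDual ℝ (EuclideanSpace ℝ (Fin n))).toLinearEquiv.finrank_eq).toContinuousLinearEquiv
  refine ⟨D, P.toContinuousLinearEquiv, by ext; rfl, fun u => ?_⟩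
  change 1 / 2 * B (P u) (P u) = _
  simp only [hP, map_sum, map_smul, sum_apply, smul_apply, hBbb, smul_eq_mul, σ.injective.eq_iff,
    mul_ite, mul_zero, Finset.sum_ite_eq', Finset.mem_univ, if_true,
    Finset.mul_sum, ← hcμ]
  refine Finset.sum_congr rfl fun i _ => ?_
  ring

end QuadraticForm


/-- **Morse Lemma.** If `f : ℝⁿ → ℝ` is smooth, the origin is a critical point,
and the Hessian matrix of `f` at the origin is non-degenerate with exactly `l`
negative eigenvalues (and `n - l` positive ones), then there are neighborhoods
`U`, `V` of the origin and a smooth diffeomorphism `ψ : V → U` with `ψ 0 = 0`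
such that `f (ψ u) = f 0 - u₁² - ⋯ - u_l² + u_{l+1}² + ⋯ + uₙ²` on `V`. -/
theorem morse_lemma (n l : ℕ) (f : EuclideanSpace ℝ (Fin n) → ℝ)
    (hf : ContDiff ℝ (⊤ : ℕ∞) f)
    (hcrit : fderiv ℝ f 0 = 0)
    (A : Matrix (Fin n) (Fin n) ℝ)
    (hAdef : ∀ i j, A i j =
      fderiv ℝ (fderiv ℝ f) 0 (EuclideanSpace.single i 1) (EuclideanSpace.single j 1))
    (hA : A.IsHermitian)
    (hdet : A.det ≠ 0)
    (hneg : (Finset.univ.filter (fun i => hA.eigenvalues i < 0)).card = l)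
    (hpos : (Finset.univ.filter (fun i => 0 < hA.eigenvalues i)).card = n - l) :
    ∃ (U V : Set (EuclideanSpace ℝ (Fin n)))
      (ψ ψinv : EuclideanSpace ℝ (Fin n) → EuclideanSpace ℝ (Fin n)),
      IsOpen U ∧ IsOpen V ∧ (0 : EuclideanSpace ℝ (Fin n)) ∈ U ∧
      (0 : EuclideanSpace ℝ (Fin n)) ∈ V ∧
      ContDiffOn ℝ (⊤ : ℕ∞) ψ V ∧ ContDiffOn ℝ (⊤ : ℕ∞) ψinv U ∧
      ψ '' V = U ∧ (∀ u ∈ V, ψinv (ψ u) = u) ∧ (∀ x ∈ U, ψ (ψinv x) = x) ∧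
      ψ 0 = 0 ∧
      ∀ u ∈ V, f (ψ u) = f 0 + ∑ i : Fin n, (if (i : ℕ) < l then -1 else 1) * (u i) ^ 2 := by
  obtain ⟨D, P, hD, hP⟩ := exists_equiv_diag (fderiv ℝ (fderiv ℝ f) 0) A hAdef hA hdet hneg
  obtain ⟨φ, h0, hφ0, hs, hs', hf'⟩ := morse_palais hf hcrit D hD
  have hφs0 : φ.symm 0 = 0 := by simpa [hφ0] using φ.left_inv h0
  refine ⟨φ.source, P ⁻¹' φ.target, φ.symm ∘ P, P.symm ∘ φ, φ.open_source,
    φ.open_target.preimage P.continuous, h0, ?_, hs'.comp P.contDiff.contDiffOn fun u hu => hu,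
    P.symm.contDiff.comp_contDiffOn hs, ?_, fun u hu => ?_, fun x hx => ?_, by simp [hφs0],
    fun u hu => ?_⟩
  · simpa [hφ0] using φ.map_source h0
  · rw [Set.image_comp, Set.image_preimage_eq _ P.surjective, φ.symm_image_target_eq_source]
  · simp [φ.right_inv hu]
  · simp [φ.left_inv hx]
  · rw [Function.comp_apply, hf' _ (φ.map_target hu), φ.right_inv hu, hP]
end

section
/- Gradient flow lines become J-holomorphic strips (Floer's key computation, flat model): let f : ℝⁿ → ℝ be smooth with Hessian H_x = second derivative of f at x viewed as a symmetric linear map ℝⁿ → ℝⁿ, and let u : ℝ → ℝⁿ be a negative gradient flow line, u'(s) = −∇f(u(s)). Define v : ℝ × ℝ → ℝⁿ × ℝⁿ by v(s,t) = φ_t(u(s), 0) = (u(s), t ∇f(u(s))), where φ_t(x,y) = (x, y + t∇f(x)). For t ∈ ℝ and x ∈ ℝⁿ let J_{t,x} : ℝⁿ × ℝⁿ → ℝⁿ × ℝⁿ be the linear map J_{t,x} = −(Dφ_t)_x ∘ J₀ ∘ (Dφ_t)_x^{−1}, where J₀(a,b) = (−b, a) and (Dφ_t)_x(a,b) = (a,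 b + t H_x a); explicitly J_{t,x}(a,b) = (b − t H_x a, t H_x b − a − t² H_x(H_x a)). Then v satisfies the Cauchy–Riemann equation ∂v/∂s (s,t) + J_{t,u(s)}( ∂v/∂t (s,t) ) = 0 for all (s,t) ∈ ℝ × ℝ. -/
/-- The gradient of a `C²` function is differentiable. -/
theorem ContDiff.differentiable_gradient {F : Type*} [NormedAddCommGroup F]
    [InnerProductSpace ℝ F] [CompleteSpace F] {f : F → ℝ} (hf : ContDiff ℝ 2 f) :
    Differentiable ℝ (gradient f) := by
  have h : Differentiable ℝ (fderiv ℝ f) :=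
    (hf.fderiv_right (m := 1) (by norm_num)).differentiable (by norm_num)
  exact (InnerProductSpace.toDual ℝ F).symm.toContinuousLinearEquiv.differentiable.comp h

/-- **Gradient flow lines become `J`-holomorphic strips (Floer's key
computation, flat model).** Let `f : ℝⁿ → ℝ` be smooth with Hessian
`Hess x = fderiv (∇f) x` (a symmetric linear map `ℝⁿ → ℝⁿ`), and let `u` be a
negative gradient flow line, `u' s = -∇f (u s)`. Set
`v (s, t) = φ_t (u s, 0) = (u s, t ∇f (u s))` and
`J_{t,x} (a, b) = (b - t Hess x a, t Hess x b - a - t² Hess x (Hess x a))`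
(which is `-(Dφ_t)_x ∘ J₀ ∘ (Dφ_t)_x⁻¹` for `J₀ (a, b) = (-b, a)` and
`(Dφ_t)_x (a, b) = (a, b + t Hess x a)`). Then `v` satisfies the
Cauchy–Riemann equation `∂v/∂s + J_{t, u s} (∂v/∂t) = 0`. -/
theorem gradient_flow_line_is_J_holomorphic (n : ℕ)
    (f : EuclideanSpace ℝ (Fin n) → ℝ) (hf : ContDiff ℝ (⊤ : ℕ∞) f)
    (u : ℝ → EuclideanSpace ℝ (Fin n))
    (hu : ∀ s : ℝ, HasDerivAt u (-gradient f (u s)) s)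
    (Hess : EuclideanSpace ℝ (Fin n) → EuclideanSpace ℝ (Fin n) → EuclideanSpace ℝ (Fin n))
    (hHess : ∀ x a, Hess x a = fderiv ℝ (gradient f) x a)
    (J : ℝ → EuclideanSpace ℝ (Fin n) →
      EuclideanSpace ℝ (Fin n) × EuclideanSpace ℝ (Fin n) →
      EuclideanSpace ℝ (Fin n) × EuclideanSpace ℝ (Fin n))
    (hJ : ∀ t x ab, J t x ab =
      (ab.2 - t • Hess x ab.1,
       t • Hess x ab.2 - ab.1 - (t ^ 2) • Hess x (Hess x ab.1)))
    (v : ℝ → ℝ → EuclideanSpace ℝ (Fin n) × EuclideanSpace ℝ (Fin n))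
    (hv : ∀ s t, v s t = (u s, t • gradient f (u s))) :
    ∀ s t : ℝ, ∃ Ws Wt : EuclideanSpace ℝ (Fin n) × EuclideanSpace ℝ (Fin n),
      HasDerivAt (fun s' => v s' t) Ws s ∧
      HasDerivAt (fun t' => v s t') Wt t ∧
      Ws + J t (u s) Wt = 0 := by
  intro s t
  have hgrad : Differentiable ℝ (gradient f) :=
    (contDiff_infty.mp hf 2).differentiable_gradient
  have hgu : HasDerivAt (fun s' => gradient f (u s'))
      (fderiv ℝ (gradient f) (u s) (-gradient f (u s))) s :=
    (hgrad (u s)).hasFDerivAt.comp_hasDerivAt s (hu s)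
  refine ⟨(-gradient f (u s), t • fderiv ℝ (gradient f) (u s) (-gradient f (u s))),
    (0, gradient f (u s)), ?_, ?_, ?_⟩
  · simp only [hv]
    exact (hu s).prodMk (hgu.const_smul t)
  · simp only [hv]
    simpa using (hasDerivAt_const t (u s)).prodMk
      ((hasDerivAt_id t).smul_const (gradient f (u s)))
  · simp [hJ, hHess]
end
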